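/- In the Laplacian model, let 0 < δ < α be given and let K = {n+1, …, (1+α)n}. There exist δ' > 0 and constants C, c > 0 (depending on p, q, α, δ) such that for all n and every set of column indices J ⊆ [(1+α)n] with K ⊆ J and |J| ≤ αn + δ'n, the submatrix of M_{(1+α−δ)n} consisting of the columns indexed by J has full column rank |J| over F_p with probability at least 1 − C·exp(−cn). -/

import Mathlib

open MeasureTheory

instance zmodMeasurableSpace (n : ℕ) : MeasurableSpace (ZMod n) := ⊤

/-- The Bernoulli-type measure on `ZMod p`: value `1` with probability `q`,
value `0` with probability `1 - q`. -/
noncomputable def bern (p : ℕ) (q : ℝ) : Measure (ZMod p) :=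
  ENNReal.ofReal q • Measure.dirac 1 + ENNReal.ofReal (1 - q) • Measure.dirac 0

instance bern_isFiniteMeasure (p : ℕ) (q : ℝ) : IsFiniteMeasure (bern p q) := by
  constructor
  simp [bern]

/-- Index type for the independent edge indicators of the random directed bipartite graph. -/
abbrev LapIdx (n a : ℕ) := Fin n × Fin a ⊕ Fin a × Fin n

/-- The product (Bernoulli) measure on the space of edge indicators. -/
noncomputable def lapMeasure (p n a : ℕ) (q : ℝ) : Measure (LapIdx n a → ZMod p) :=
  Measure.pi fun _ => bern p q

/-- The Laplacian of the random directed bipartite graph on parts of sizes `n` and `a`,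
as a function of the edge indicators `ω`. -/
def lapM (p n a : ℕ) (ω : LapIdx n a → ZMod p) :
    Matrix (Fin (n + a)) (Fin (n + a)) (ZMod p) := fun i j =>
  if hi : (i : ℕ) < n then
    if hj : (j : ℕ) < n then
      (if (i : ℕ) = (j : ℕ) then -∑ k : Fin a, ω (Sum.inl (⟨i, hi⟩, k)) else 0)
    else ω (Sum.inl (⟨i, hi⟩, ⟨(j : ℕ) - n, by have := j.isLt; omega⟩))
  else
    if hj : (j : ℕ) < n then
      ω (Sum.inr (⟨(i : ℕ) - n, by have := i.isLt; omega⟩, ⟨j, hj⟩))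
    else
      (if (i : ℕ) = (j : ℕ) then
        -∑ k : Fin n, ω (Sum.inr (⟨(i : ℕ) - n, by have := i.isLt; omega⟩, k)) else 0)

/-- The submatrix consisting of the first `m` rows of the Laplacian. -/
def firstRows (p n a m : ℕ) (h : m ≤ n + a) (ω : LapIdx n a → ZMod p) :
    Matrix (Fin m) (Fin (n + a)) (ZMod p) :=
  fun i j => lapM p n a ω (Fin.castLE h i) j

lemma addChar_map_sum {A M ι : Type*} [AddCommMonoid A] [CommMonoid M] (ψ : AddChar A M)
    (s : Finset ι) (f : ι → A) : ψ (∑ i ∈ s, f i) = ∏ i ∈ s, ψ (f i) := by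
  induction s using Finset.cons_induction with
  | empty => simp
  | cons i s hi ih => rw [Finset.sum_cons, Finset.prod_cons, AddChar.map_add_eq_mul, ih]

lemma sum_ite_ne_zero (p : ℕ) [NeZero p] (z : ℝ) :
    ∑ x : ZMod p, (if x ≠ 0 then z else 1) = 1 + (p - 1) * z := by
  rw [← Finset.add_sum_erase _ _ (Finset.mem_univ (0 : ZMod p)),
    Finset.sum_congr rfl (g := fun _ => z)]
  · rw [Finset.sum_const, Finset.card_erase_of_mem (Finset.mem_univ _), Finset.card_univ,
      ZMod.card, nsmul_eq_mul, Nat.cast_sub (Nat.one_le_iff_ne_zero.2 (NeZero.ne p))]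
    simp
  · intro x hx
    rw [if_pos (Finset.ne_of_mem_erase hx)]

lemma bern_isProbabilityMeasure (p : ℕ) {q : ℝ} (hq0 : 0 ≤ q) (hq1 : q ≤ 1) :
    IsProbabilityMeasure (bern p q) := by
  constructor
  simp only [bern, Measure.coe_add, Measure.coe_smul, Pi.add_apply, Pi.smul_apply,
    measure_univ, smul_eq_mul, mul_one]
  rw [← ENNReal.ofReal_add hq0 (by linarith)]
  simp

lemma integral_bern (p : ℕ) [NeZero p] {q : ℝ} (hq0 : 0 ≤ q) (hq1 : q ≤ 1) (f : ZMod p → ℂ) :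
    ∫ x, f x ∂(bern p q) = q * f 1 + (1 - q) * f 0 := by
  have hi : ∀ (μ : Measure (ZMod p)) [IsFiniteMeasure μ], Integrable f μ := fun μ _ =>
    Integrable.of_finite
  rw [bern, integral_add_measure ((hi _).smul_measure (by simp)) ((hi _).smul_measure (by simp)),
    integral_smul_measure, integral_smul_measure, integral_dirac, integral_dirac,
    ENNReal.toReal_ofReal hq0, ENNReal.toReal_ofReal (by linarith)]
  simp

lemma norm_convexCombination_lt_one {q : ℝ} (hq0 : 0 < q) (hq1 : q < 1) {z : ℂ}
    (hz : ‖z‖ = 1) (hz1 : z ≠ 1) : ‖(q : ℂ) * z + (1 - q) * 1‖ < 1 := by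
  have hsq : z.re ^ 2 + z.im ^ 2 = 1 := by
    have h := Complex.sq_norm z
    rw [hz, Complex.normSq_apply] at h
    linarith
  have hre : z.re < 1 := by
    by_contra! h
    apply hz1
    apply Complex.ext <;> simp <;> nlinarith [sq_nonneg z.im]
  have h : ‖(q : ℂ) * z + (1 - q) * 1‖ ^ 2 < 1 := by
    rw [Complex.sq_norm, Complex.normSq_apply]
    simp
    have h' : (q * z.re + (1 - q)) * (q * z.re + (1 - q)) + q * z.im * (q * z.im) =
        1 - 2 * (q * (1 - q) * (1 - z.re)) := by
      linear_combination q ^ 2 * hsq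
    linarith [mul_pos (mul_pos hq0 (sub_pos.2 hq1)) (sub_pos.2 hre)]
  nlinarith [norm_nonneg ((q : ℂ) * z + (1 - q) * 1)]

/-- The characteristic function of a Bernoulli variable modulo `p` is uniformly bounded away
from `1` at nontrivial frequencies. -/
lemma exists_norm_integral_stdAddChar_le (p : ℕ) [NeZero p] {q : ℝ} (hq0 : 0 < q)
    (hq1 : q < 1) : ∃ l : ℝ, 0 < l ∧ l < 1 ∧ ∀ t : ZMod p, t ≠ 0 →
      ‖∫ x, ZMod.stdAddChar (t * x) ∂(bern p q)‖ ≤ l := by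
  have key : ∀ t : ZMod p, t ≠ 0 → ‖∫ x, ZMod.stdAddChar (t * x) ∂(bern p q)‖ < 1 := by
    intro t ht
    rw [integral_bern p hq0.le hq1.le]
    simp only [mul_one, mul_zero, AddChar.map_zero_eq_one]
    have := norm_convexCombination_lt_one hq0 hq1 (z := ZMod.stdAddChar t)
      (by rw [ZMod.stdAddChar_apply]; exact Circle.norm_coe _)
      (fun h => ht (ZMod.injective_stdAddChar (by rw [h, AddChar.map_zero_eq_one])))
    simpa using this
  let S : Finset ℝ := insert (1 / 2) ((Finset.univ.filter fun t : ZMod p => t ≠ 0).image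
    fun t => ‖∫ x, ZMod.stdAddChar (t * x) ∂(bern p q)‖)
  have hS : S.Nonempty := ⟨1 / 2, by simp [S]⟩
  refine ⟨S.max' hS, ?_, ?_, fun t ht => ?_⟩
  · exact lt_of_lt_of_le (by norm_num) (S.le_max' (1 / 2) (by simp [S]))
  · rw [Finset.max'_lt_iff]
    intro y hy
    simp only [S, Finset.mem_insert, Finset.mem_image, Finset.mem_filter, Finset.mem_univ,
      true_and] at hy
    rcases hy with rfl | ⟨t, ht, rfl⟩
    · norm_num
    · exact key t ht
  · apply S.le_max'
    simp only [S, Finset.mem_insert, Finset.mem_image, Finset.mem_filter, Finset.mem_univ,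
      true_and]
    exact Or.inr ⟨t, ht, rfl⟩

/-- The Fourier upper bound for the probability that a linear form with `s` nonzero
coefficients in Bernoulli variables vanishes modulo `p`. -/
noncomputable def vanishBound (p : ℕ) (l : ℝ) (s : ℕ) : ℝ := (1 + (p - 1) * l ^ s) / p

lemma measureReal_linearForms_eq_zero_le (p : ℕ) [Fact p.Prime] {q : ℝ} (hq0 : 0 < q)
    (hq1 : q < 1) {l : ℝ}
    (hl : ∀ t : ZMod p, t ≠ 0 → ‖∫ x, ZMod.stdAddChar (t * x) ∂(bern p q)‖ ≤ l)
    {ι R : Type*} [Fintype ι] [Fintype R] [DecidableEq R] (row : ι → R) (d : ι → ZMod p) :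
    (Measure.pi fun _ : ι => bern p q).real
      {ω | ∀ r, ∑ i, (if row i = r then d i * ω i else 0) = 0} ≤
      ∏ r, vanishBound p l (Finset.univ.filter fun i => row i = r ∧ d i ≠ 0).card := by
  have hprob := bern_isProbabilityMeasure p hq0.le hq1.le
  have hp0 : (p : ℂ) ≠ 0 := Nat.cast_ne_zero.2 (NeZero.ne p)
  have hpR : (0 : ℝ) < p := Nat.cast_pos.2 (NeZero.pos p)
  set μ := Measure.pi fun _ : ι => bern p q with hμ
  set E : Set (ι → ZMod p) := {ω | ∀ r, ∑ i, (if row i = r then d i * ω i else 0) = 0} with hE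
  have hind : ∀ ω, E.indicator (fun _ => (1 : ℂ)) ω =
      ∑ t : R → ZMod p, ((p : ℂ)⁻¹) ^ Fintype.card R *
        ∏ i, ZMod.stdAddChar (t (row i) * d i * ω i) := by
    intro ω
    have h1 : E.indicator (fun _ => (1 : ℂ)) ω = ∏ r : R, ((p : ℂ)⁻¹ *
        ∑ t : ZMod p, ZMod.stdAddChar (t * ∑ i, (if row i = r then d i * ω i else 0))) := by
      simp_rw [AddChar.sum_mulShift _ (ZMod.isPrimitive_stdAddChar p), ZMod.card]
      by_cases h : ω ∈ E
      · rw [Set.indicator_of_mem h, Finset.prod_eq_one]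
        intro r _
        rw [if_pos (h r), inv_mul_cancel₀ hp0]
      · rw [Set.indicator_of_notMem h]
        simp only [hE, Set.mem_ofPred_eq, not_forall] at h
        obtain ⟨r, hr⟩ := h
        rw [Finset.prod_eq_zero (Finset.mem_univ r)]
        rw [if_neg hr]
        simp
    rw [h1, Finset.prod_mul_distrib, Finset.prod_const, Finset.card_univ, ← Finset.mul_sum]
    congr 1
    rw [Finset.prod_univ_sum, Fintype.piFinset_univ]
    refine Finset.sum_congr rfl fun t _ => ?_
    rw [← addChar_map_sum, ← addChar_map_sum]
    congr 1
    simp_rw [Finset.mul_sum]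
    rw [Finset.sum_comm]
    refine Finset.sum_congr rfl fun i _ => ?_
    simp [mul_assoc]
  have hEm : MeasurableSet E := E.toFinite.measurableSet
  have hint : (μ.real E : ℂ) = ∑ t : R → ZMod p, ((p : ℂ)⁻¹) ^ Fintype.card R *
        ∏ i, ∫ x, ZMod.stdAddChar (t (row i) * d i * x) ∂(bern p q) := by
    have h2 : (μ.real E : ℂ) = ∫ ω, E.indicator (fun _ => (1 : ℂ)) ω ∂μ := by
      rw [integral_indicator hEm]
      simp
    rw [h2]
    simp_rw [hind]
    rw [integral_finsetSum _ fun t _ => Integrable.of_finite]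
    refine Finset.sum_congr rfl fun t _ => ?_
    rw [integral_const_mul, hμ, integral_fintype_prod_eq_prod
      (f := fun i x => ZMod.stdAddChar (t (row i) * d i * x))]
  have hnorm : ∀ t : R → ZMod p,
      ‖((p : ℂ)⁻¹) ^ Fintype.card R *
        ∏ i, ∫ x, ZMod.stdAddChar (t (row i) * d i * x) ∂(bern p q)‖ ≤
      ∏ r, (p : ℝ)⁻¹ * (if t r ≠ 0 then
        l ^ (Finset.univ.filter fun i => row i = r ∧ d i ≠ 0).card else 1) := by
    intro t
    rw [norm_mul, norm_pow, norm_inv, Complex.norm_natCast, norm_prod, Finset.prod_mul_distrib,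
      Finset.prod_const, Finset.card_univ]
    refine mul_le_mul_of_nonneg_left ?_ (by positivity)
    calc ∏ i, ‖∫ x, ZMod.stdAddChar (t (row i) * d i * x) ∂(bern p q)‖
        ≤ ∏ i, (if t (row i) ≠ 0 ∧ d i ≠ 0 then l else 1) := by
          refine Finset.prod_le_prod (fun _ _ => norm_nonneg _) fun i _ => ?_
          split_ifs with h
          · exact hl _ (mul_ne_zero h.1 h.2)
          · have : t (row i) * d i = 0 := by
              rw [mul_eq_zero]; tauto
            simp [this]
      _ = ∏ r, ∏ i with row i = r, (if t (row i) ≠ 0 ∧ d i ≠ 0 then l else 1) :=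
          (Finset.prod_fiberwise _ _ _).symm
      _ ≤ _ := by
          refine le_of_eq (Finset.prod_congr rfl fun r _ => ?_)
          split_ifs with h
          · rw [← Finset.filter_filter, ← Finset.prod_const, Finset.prod_filter (fun i => d i ≠ 0)]
            refine Finset.prod_congr rfl fun i hi => ?_
            rw [Finset.mem_filter] at hi
            rw [hi.2]
            simp [h]
          · refine Finset.prod_eq_one fun i hi => ?_
            rw [Finset.mem_filter] at hi
            rw [hi.2, if_neg (fun h' => h h'.1)]
  calc μ.real E = ‖(μ.real E : ℂ)‖ := by
        rw [Complex.norm_real, Real.norm_of_nonneg measureReal_nonneg]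
    _ ≤ ∑ t : R → ZMod p, ∏ r, (p : ℝ)⁻¹ * (if t r ≠ 0 then
        l ^ (Finset.univ.filter fun i => row i = r ∧ d i ≠ 0).card else 1) := by
        rw [hint]
        exact (norm_sum_le _ _).trans (Finset.sum_le_sum fun t _ => hnorm t)
    _ = _ := by
        rw [← Fintype.piFinset_univ, ← Finset.prod_univ_sum (fun _ => Finset.univ)
          (fun r x => (p : ℝ)⁻¹ * (if x ≠ 0 then
            l ^ (Finset.univ.filter fun i => row i = r ∧ d i ≠ 0).card else 1))]
        refine Finset.prod_congr rfl fun r _ => ?_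
        rw [← Finset.mul_sum, sum_ite_ne_zero, vanishBound]
        field_simp

section vanishBound

variable {p : ℕ} [NeZero p] {l : ℝ}

lemma one_le_cast_modulus (p : ℕ) [NeZero p] : (1 : ℝ) ≤ p :=
  Nat.one_le_cast.2 (Nat.one_le_iff_ne_zero.2 (NeZero.ne p))

lemma inv_le_vanishBound (hl0 : 0 ≤ l) (s : ℕ) : (p : ℝ)⁻¹ ≤ vanishBound p l s := by
  have := one_le_cast_modulus p
  rw [vanishBound, inv_eq_one_div]
  gcongr
  have := mul_nonneg (sub_nonneg.2 this) (pow_nonneg hl0 s)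
  linarith

lemma vanishBound_pos (hl0 : 0 ≤ l) (s : ℕ) : 0 < vanishBound p l s :=
  lt_of_lt_of_le (inv_pos.2 (Nat.cast_pos.2 (NeZero.pos p))) (inv_le_vanishBound hl0 s)

lemma vanishBound_antitone (hl0 : 0 ≤ l) (hl1 : l ≤ 1) : Antitone (vanishBound p l) := by
  intro s t hst
  have := sub_nonneg.2 (one_le_cast_modulus p)
  have := pow_le_pow_of_le_one hl0 hl1 hst
  rw [vanishBound, vanishBound]
  gcongr

lemma vanishBound_zero : vanishBound p l 0 = 1 := by
  have : (p : ℝ) ≠ 0 := Nat.cast_ne_zero.2 (NeZero.ne p)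
  rw [vanishBound]
  field_simp
  ring

lemma vanishBound_le_one (hl0 : 0 ≤ l) (hl1 : l ≤ 1) (s : ℕ) : vanishBound p l s ≤ 1 := by
  rw [← vanishBound_zero (p := p) (l := l)]
  exact vanishBound_antitone hl0 hl1 (Nat.zero_le s)

end vanishBound

lemma vanishBound_one_lt_one {p : ℕ} [Fact p.Prime] {l : ℝ} (hl1 : l < 1) : vanishBound p l 1 < 1 := by
  have : (1 : ℝ) < p := Nat.one_lt_cast.2 (Fact.out : p.Prime).one_lt
  rw [vanishBound, div_lt_one (by linarith), pow_one]
  nlinarith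

/-- The event that `(u, w)` is annihilated by the first `n + m` rows of the Laplacian. -/
def kernelEvent (p n a m : ℕ) (u : Fin n → ZMod p) (w : Fin a → ZMod p) :
    Set (LapIdx n a → ZMod p) :=
  {ω | (∀ i, ∑ k, (w k - u i) * ω (Sum.inl (i, k)) = 0) ∧
    ∀ j : Fin a, (j : ℕ) < m → ∑ i, (u i - w j) * ω (Sum.inr (j, i)) = 0}

lemma measureReal_kernelEvent_le (p : ℕ) [Fact p.Prime] {q : ℝ} (hq0 : 0 < q)
    (hq1 : q < 1) {l : ℝ}
    (hl : ∀ t : ZMod p, t ≠ 0 → ‖∫ x, ZMod.stdAddChar (t * x) ∂(bern p q)‖ ≤ l)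
    (n a m : ℕ) (u : Fin n → ZMod p) (w : Fin a → ZMod p) :
    (lapMeasure p n a q).real (kernelEvent p n a m u w) ≤
      (∏ i, vanishBound p l (Finset.univ.filter fun k => w k ≠ u i).card) *
      ∏ j : Fin a, if (j : ℕ) < m then
        vanishBound p l (Finset.univ.filter fun i => u i ≠ w j).card else 1 := by
  have hprob := bern_isProbabilityMeasure p hq0.le hq1.le
  let row : LapIdx n a → Fin n ⊕ Fin a := Sum.map Prod.fst Prod.fst
  let d : LapIdx n a → ZMod p := Sum.elim (fun e => w e.2 - u e.1)
    (fun e => if (e.1 : ℕ) < m then u e.2 - w e.1 else 0)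
  have hinl : ∀ i : Fin n, (Finset.univ.filter fun e => row e = Sum.inl i ∧ d e ≠ 0).card =
      (Finset.univ.filter fun k => w k ≠ u i).card := by
    intro i
    symm
    refine Finset.card_bij (fun k _ => Sum.inl (i, k)) ?_ ?_ ?_
    · intro k hk
      simpa [row, d, sub_eq_zero] using hk
    · intro k _ k' _ h
      simpa using h
    · rintro (⟨i', k⟩ | ⟨j, i'⟩) he
      · simp only [row, d, Finset.mem_filter, Finset.mem_univ, true_and, Sum.map_inl,
          Sum.inl.injEq, Sum.elim_inl, ne_eq, sub_eq_zero] at he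
        obtain ⟨rfl, he⟩ := he
        exact ⟨k, by simpa using he, rfl⟩
      · simp [row] at he
  have hinr : ∀ j : Fin a, (Finset.univ.filter fun e => row e = Sum.inr j ∧ d e ≠ 0).card =
      if (j : ℕ) < m then (Finset.univ.filter fun i => u i ≠ w j).card else 0 := by
    intro j
    split_ifs with hj
    · symm
      refine Finset.card_bij (fun i _ => Sum.inr (j, i)) ?_ ?_ ?_
      · intro i hi
        simpa [row, d, sub_eq_zero, hj] using hi
      · intro k _ k' _ h
        simpa using h
      · rintro (⟨i', k⟩ | ⟨j', i'⟩) he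
        · simp [row] at he
        · simp only [row, d, Finset.mem_filter, Finset.mem_univ, true_and, Sum.map_inr,
            Sum.inr.injEq, Sum.elim_inr, ne_eq] at he
          obtain ⟨rfl, he⟩ := he
          rw [if_pos hj, sub_eq_zero] at he
          exact ⟨i', by simpa using he, rfl⟩
    · rw [Finset.card_eq_zero, Finset.filter_eq_empty_iff]
      rintro (⟨i', k⟩ | ⟨j', i'⟩) - he
      · simp [row] at he
      · simp only [row, d, Sum.map_inr, Sum.inr.injEq, Sum.elim_inr, ne_eq] at he
        obtain ⟨rfl, he⟩ := he
        exact he (if_neg hj)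
  have hsub : kernelEvent p n a m u w ⊆
      {ω | ∀ r, ∑ e, (if row e = r then d e * ω e else 0) = 0} := by
    rintro ω ⟨h1, h2⟩ (i | j)
    · rw [Fintype.sum_sum_type, Fintype.sum_prod_type, Fintype.sum_prod_type,
        Finset.sum_eq_single i]
      · simpa [row, d] using h1 i
      · intro i' _ hi'
        simp [row, hi']
      · simp
    · rw [Fintype.sum_sum_type, Fintype.sum_prod_type, Fintype.sum_prod_type, add_comm,
        Finset.sum_eq_single j]
      · by_cases hj : (j : ℕ) < m
        · simpa [row, d, hj] using h2 j hj
        · simp [row, d, hj]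
      · intro j' _ hj'
        simp [row, hj']
      · simp
  rw [lapMeasure]
  refine (measureReal_mono hsub (measure_ne_top _ _)).trans
    ((measureReal_linearForms_eq_zero_le p hq0 hq1 hl row d).trans (le_of_eq ?_))
  rw [Fintype.prod_sum_type]
  simp_rw [hinl, hinr]
  congr 1
  refine Finset.prod_congr rfl fun j _ => ?_
  split_ifs
  · rfl
  · exact vanishBound_zero

lemma prod_le_pow_card_compl {ι : Type*} [Fintype ι] [DecidableEq ι] (T : Finset ι) {x : ι → ℝ}
    {B : ℝ} (h0 : ∀ i, 0 ≤ x i) (h1 : ∀ i, x i ≤ 1) (hB : ∀ i ∉ T, x i ≤ B) :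
    ∏ i, x i ≤ B ^ (Fintype.card ι - T.card) := by
  rw [← Finset.prod_mul_prod_compl T x, ← Finset.card_compl, ← Finset.prod_const]
  calc (∏ i ∈ T, x i) * ∏ i ∈ Tᶜ, x i ≤ 1 * ∏ i ∈ Tᶜ, x i :=
        mul_le_mul_of_nonneg_right (Finset.prod_le_one (fun i _ => h0 i) fun i _ => h1 i)
          (Finset.prod_nonneg fun i _ => h0 i)
    _ ≤ _ := by
        rw [one_mul]
        exact Finset.prod_le_prod (fun i _ => h0 i) fun i hi => hB i (Finset.mem_compl.1 hi)

lemma card_filter_fin_lt {a m : ℕ} (h : m ≤ a) :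
    (Finset.univ.filter fun j : Fin a => (j : ℕ) < m).card = m := by
  rw [Fin.card_filter_val_lt, min_eq_right h]

lemma prod_ite_fin_lt {a m : ℕ} (h : m ≤ a) (x y : ℝ) :
    ∏ j : Fin a, (if (j : ℕ) < m then x else y) = x ^ m * y ^ (a - m) := by
  rw [Finset.prod_ite, Finset.prod_const, Finset.prod_const, card_filter_fin_lt h,
    Finset.filter_not, Finset.card_sdiff_of_subset (Finset.filter_subset _ _),
    card_filter_fin_lt h, Finset.card_univ, Fintype.card_fin]

lemma prod_vanishBound_le {p : ℕ} [Fact p.Prime] {l : ℝ} (hl0 : 0 < l) (hl1 : l < 1)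
    {n a m s : ℕ} {z : ℝ} (hz0 : 0 < z) (hz1 : z ≤ 1) (hma : m ≤ a) (T : Finset (Fin n))
    (hs : s ≤ n - T.card) {u : Fin n → ZMod p} {w : Fin a → ZMod p}
    (hu : ∀ i ∉ T, u i = 0) (huw : u ≠ 0 ∨ w ≠ 0) :
    (∏ i, vanishBound p l (Finset.univ.filter fun k => w k ≠ u i).card) *
      (∏ j : Fin a, if (j : ℕ) < m then
        vanishBound p l (Finset.univ.filter fun i => u i ≠ w j).card else 1) ≤
      (if w = 0 then vanishBound p l 1 ^ m else 0) +
      vanishBound p l 1 ^ (n - T.card) * (z ^ s)⁻¹ * (∏ k, if w k ≠ 0 then z else 1) +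
      vanishBound p l s ^ (n - T.card) *
        ∏ j : Fin a, (if (j : ℕ) < m then (if w j ≠ 0 then vanishBound p l s else 1) else 1) := by
  have hpos := vanishBound_pos (p := p) hl0.le
  have hle := vanishBound_le_one (p := p) hl0.le hl1.le
  have hanti := vanishBound_antitone (p := p) hl0.le hl1.le
  set X := ∏ i, vanishBound p l (Finset.univ.filter fun k => w k ≠ u i).card with hX
  set Y := ∏ j : Fin a, (if (j : ℕ) < m then
        vanishBound p l (Finset.univ.filter fun i => u i ≠ w j).card else 1) with hY
  have hX0 : 0 ≤ X := Finset.prod_nonneg fun i _ => (hpos _).le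
  have hX1 : X ≤ 1 := Finset.prod_le_one (fun i _ => (hpos _).le) fun i _ => hle _
  have hY0 : 0 ≤ Y := Finset.prod_nonneg fun i _ => by split_ifs <;> [exact (hpos _).le; simp]
  have hY1 : Y ≤ 1 := Finset.prod_le_one
    (fun i _ => by split_ifs <;> [exact (hpos _).le; simp])
    (fun i _ => by split_ifs <;> [exact hle _; simp])
  have hZ0 : 0 ≤ ∏ k, (if w k ≠ 0 then z else 1) :=
    Finset.prod_nonneg fun i _ => by split_ifs <;> [exact hz0.le; simp]
  have hV0 : 0 ≤ ∏ j : Fin a, (if (j : ℕ) < m then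
      (if w j ≠ 0 then vanishBound p l s else 1) else 1) :=
    Finset.prod_nonneg fun i _ => by split_ifs <;> first | exact (hpos _).le | simp
  have hA0 := pow_pos (hpos 1) (n - T.card)
  have hB0 := pow_pos (hpos s) (n - T.card)
  have hzs := inv_pos.2 (pow_pos hz0 s)
  by_cases hw : w = 0
  · have hu' : u ≠ 0 := by tauto
    obtain ⟨i, hi⟩ := Function.ne_iff.1 hu'
    have : X * Y ≤ vanishBound p l 1 ^ m := by
      calc X * Y ≤ 1 * Y := mul_le_mul_of_nonneg_right hX1 hY0
        _ ≤ ∏ j : Fin a, (if (j : ℕ) < m then vanishBound p l 1 else 1) := by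
          rw [one_mul]
          refine Finset.prod_le_prod
            (fun i _ => by split_ifs <;> [exact (hpos _).le; simp]) fun j _ => ?_
          split_ifs
          · refine hanti (Finset.card_pos.2 ⟨i, ?_⟩)
            simpa [hw] using hi
          · exact le_rfl
        _ = _ := by rw [prod_ite_fin_lt hma]; simp
    rw [if_pos hw]
    have h2 := mul_nonneg (mul_nonneg hA0.le hzs.le) hZ0
    have h3 := mul_nonneg hB0.le hV0
    linarith
  · rw [if_neg hw, zero_add]
    have hXc : X ≤ vanishBound p l (Finset.univ.filter fun k => w k ≠ 0).card ^ (n - T.card) := by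
      have := prod_le_pow_card_compl T
        (x := fun i => vanishBound p l (Finset.univ.filter fun k => w k ≠ u i).card)
        (B := vanishBound p l (Finset.univ.filter fun k => w k ≠ 0).card)
        (fun i => (hpos _).le) (fun i => hle _) (fun i hi => by rw [hu i hi])
      simpa using this
    rcases le_total (Finset.univ.filter fun k => w k ≠ 0).card s with hc | hc
    · have hc1 : 1 ≤ (Finset.univ.filter fun k => w k ≠ 0).card := by
        obtain ⟨k, hk⟩ := Function.ne_iff.1 hw
        exact Finset.card_pos.2 ⟨k, by simpa using hk⟩
      have h1 : X ≤ vanishBound p l 1 ^ (n - T.card) :=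
        hXc.trans (pow_le_pow_left₀ (hpos _).le (hanti hc1) _)
      have h2 : z ^ s ≤ ∏ k, (if w k ≠ 0 then z else 1) := by
        rw [Finset.prod_ite, Finset.prod_const, Finset.prod_const_one, mul_one]
        exact pow_le_pow_of_le_one hz0.le hz1 hc
      have h3 : 1 ≤ (z ^ s)⁻¹ * ∏ k, (if w k ≠ 0 then z else 1) := by
        calc (1 : ℝ) = (z ^ s)⁻¹ * z ^ s := (inv_mul_cancel₀ (pow_pos hz0 s).ne').symm
          _ ≤ _ := mul_le_mul_of_nonneg_left h2 hzs.le
      have h4 : X * Y ≤ vanishBound p l 1 ^ (n - T.card) *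
          ((z ^ s)⁻¹ * ∏ k, (if w k ≠ 0 then z else 1)) := by
        calc X * Y ≤ X * 1 := mul_le_mul_of_nonneg_left hY1 hX0
          _ ≤ vanishBound p l 1 ^ (n - T.card) * 1 := by simpa using h1
          _ ≤ _ := mul_le_mul_of_nonneg_left h3 hA0.le
      have h5 := mul_nonneg hB0.le hV0
      rw [mul_assoc]
      linarith
    · have h1 : X ≤ vanishBound p l s ^ (n - T.card) :=
        hXc.trans (pow_le_pow_left₀ (hpos _).le (hanti hc) _)
      have h2 : Y ≤ ∏ j : Fin a, (if (j : ℕ) < m then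
          (if w j ≠ 0 then vanishBound p l s else 1) else 1) := by
        refine Finset.prod_le_prod
            (fun i _ => by split_ifs <;> [exact (hpos _).le; simp]) fun j _ => ?_
        split_ifs with hj hwj
        · refine hanti (hs.trans ?_)
          have : Tᶜ ⊆ Finset.univ.filter fun i => u i ≠ w j := by
            intro i hi
            rw [Finset.mem_filter, hu i (Finset.mem_compl.1 hi)]
            exact ⟨Finset.mem_univ _, Ne.symm hwj⟩
          simpa [Finset.card_compl] using Finset.card_le_card this
        · exact hle _
        · exact le_rfl
      have h3 := mul_le_mul h1 h2 hY0 hB0.le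
      have h4 := mul_nonneg (mul_nonneg hA0.le hzs.le) hZ0
      linarith

lemma sum_prod_ite_ne_zero (p : ℕ) [NeZero p] (a : ℕ) (z : ℝ) :
    ∑ w : Fin a → ZMod p, ∏ k, (if w k ≠ 0 then z else 1) = (1 + (p - 1) * z) ^ a := by
  rw [← Fintype.piFinset_univ, ← Finset.prod_univ_sum (fun _ => Finset.univ)
    (fun _ x => if x ≠ 0 then z else 1)]
  simp_rw [sum_ite_ne_zero]
  simp

lemma sum_prod_ite_lt_ne_zero (p : ℕ) [NeZero p] {a m : ℕ} (h : m ≤ a) (z : ℝ) :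
    ∑ w : Fin a → ZMod p,
        ∏ k : Fin a, (if (k : ℕ) < m then (if w k ≠ 0 then z else 1) else 1) =
      (1 + (p - 1) * z) ^ m * (p : ℝ) ^ (a - m) := by
  rw [← Fintype.piFinset_univ, ← Finset.prod_univ_sum (fun _ => Finset.univ)
    (fun (k : Fin a) x => if (k : ℕ) < m then (if x ≠ 0 then z else 1) else 1),
    ← prod_ite_fin_lt h]
  refine Finset.prod_congr rfl fun k _ => ?_
  split_ifs
  · rw [sum_ite_ne_zero]
  · simp

/-- First-moment bound for the existence of a nonzero kernel vector whose first `n`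
coordinates are supported on `T`. -/
lemma measureReal_exists_kernelEvent_le (p : ℕ) [Fact p.Prime] {q : ℝ} (hq0 : 0 < q)
    (hq1 : q < 1) {l : ℝ} (hl0 : 0 < l) (hl1 : l < 1)
    (hl : ∀ t : ZMod p, t ≠ 0 → ‖∫ x, ZMod.stdAddChar (t * x) ∂(bern p q)‖ ≤ l)
    {n a m s : ℕ} {z : ℝ} (hz0 : 0 < z) (hz1 : z ≤ 1) (hma : m ≤ a) (T : Finset (Fin n))
    (hs : s ≤ n - T.card) :
    (lapMeasure p n a q).real {ω | ∃ u : Fin n → ZMod p, ∃ w : Fin a → ZMod p,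
      (∀ i ∉ T, u i = 0) ∧ (u ≠ 0 ∨ w ≠ 0) ∧ ω ∈ kernelEvent p n a m u w} ≤
    (p : ℝ) ^ T.card * (vanishBound p l 1 ^ m +
      vanishBound p l 1 ^ (n - T.card) * (z ^ s)⁻¹ * (1 + (p - 1) * z) ^ a +
      vanishBound p l s ^ (n - T.card) *
        ((1 + (p - 1) * vanishBound p l s) ^ m * (p : ℝ) ^ (a - m))) := by
  have hprob := bern_isProbabilityMeasure p hq0.le hq1.le
  have hfin : IsFiniteMeasure (lapMeasure p n a q) := by
    rw [lapMeasure]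
    infer_instance
  let U : Finset (Fin n → ZMod p) :=
    Fintype.piFinset fun i => if i ∈ T then Finset.univ else {0}
  have hU : ∀ u, u ∈ U ↔ ∀ i ∉ T, u i = 0 := by
    intro u
    rw [Fintype.mem_piFinset]
    refine forall_congr' fun i => ?_
    by_cases hi : i ∈ T <;> simp [hi]
  have hUc : U.card = p ^ T.card := by
    rw [Fintype.card_piFinset]
    have : ∀ i : Fin n, (if i ∈ T then (Finset.univ : Finset (ZMod p)) else {0}).card =
        if i ∈ T then p else 1 := by
      intro i
      split_ifs <;> simp [ZMod.card]
    simp_rw [this]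
    simp
  let V : Finset ((Fin n → ZMod p) × (Fin a → ZMod p)) :=
    (U ×ˢ Finset.univ).filter fun v => v.1 ≠ 0 ∨ v.2 ≠ 0
  let F : (Fin a → ZMod p) → ℝ := fun w => (if w = 0 then vanishBound p l 1 ^ m else 0) +
      vanishBound p l 1 ^ (n - T.card) * (z ^ s)⁻¹ * (∏ k, if w k ≠ 0 then z else 1) +
      vanishBound p l s ^ (n - T.card) *
        ∏ j : Fin a, (if (j : ℕ) < m then (if w j ≠ 0 then vanishBound p l s else 1) else 1)
  have hpos := vanishBound_pos (p := p) hl0.le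
  have hF : ∀ w, 0 ≤ F w := by
    intro w
    have h1 := (hpos 1).le
    have h2 := (hpos s).le
    refine add_nonneg (add_nonneg ?_ (mul_nonneg (by positivity)
      (Finset.prod_nonneg fun i _ => ?_))) (mul_nonneg (by positivity)
      (Finset.prod_nonneg fun i _ => ?_))
    all_goals split_ifs <;> positivity
  have hsub : {ω | ∃ u : Fin n → ZMod p, ∃ w : Fin a → ZMod p,
      (∀ i ∉ T, u i = 0) ∧ (u ≠ 0 ∨ w ≠ 0) ∧ ω ∈ kernelEvent p n a m u w} ⊆
      ⋃ v ∈ V, kernelEvent p n a m v.1 v.2 := by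
    rintro ω ⟨u, w, hu, huw, hω⟩
    rw [Set.mem_iUnion₂]
    refine ⟨(u, w), ?_, hω⟩
    simp only [V, Finset.mem_filter, Finset.mem_product, Finset.mem_univ, and_true]
    exact ⟨(hU u).2 hu, huw⟩
  calc _ ≤ ∑ v ∈ V, (lapMeasure p n a q).real (kernelEvent p n a m v.1 v.2) :=
        (measureReal_mono hsub (measure_ne_top _ _)).trans (measureReal_biUnion_finset_le _ _)
    _ ≤ ∑ v ∈ V, F v.2 := by
        refine Finset.sum_le_sum fun v hv => ?_
        simp only [V, Finset.mem_filter, Finset.mem_product, Finset.mem_univ, and_true] at hv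
        exact (measureReal_kernelEvent_le p hq0 hq1 hl n a m v.1 v.2).trans
          (prod_vanishBound_le hl0 hl1 hz0 hz1 hma T hs ((hU _).1 hv.1) hv.2)
    _ ≤ ∑ v ∈ U ×ˢ Finset.univ, F v.2 :=
        Finset.sum_le_sum_of_subset_of_nonneg (Finset.filter_subset _ _) fun v _ _ => hF _
    _ = _ := by
        rw [Finset.sum_product]
        simp only [F]
        rw [Finset.sum_const, hUc, nsmul_eq_mul, Nat.cast_pow]
        rw [Finset.sum_add_distrib, Finset.sum_add_distrib, ← Finset.mul_sum, ← Finset.mul_sum,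
          sum_prod_ite_ne_zero, sum_prod_ite_lt_ne_zero p hma]
        simp

section lapM

variable (p n a : ℕ) (ω : LapIdx n a → ZMod p)

lemma lapM_castAdd_castAdd (i i' : Fin n) :
    lapM p n a ω (Fin.castAdd a i) (Fin.castAdd a i') =
      if i = i' then -∑ k, ω (Sum.inl (i, k)) else 0 := by
  simp [lapM, Fin.ext_iff]

lemma lapM_castAdd_natAdd (i : Fin n) (k : Fin a) :
    lapM p n a ω (Fin.castAdd a i) (Fin.natAdd n k) = ω (Sum.inl (i, k)) := by
  simp [lapM]

lemma lapM_natAdd_castAdd (j : Fin a) (i : Fin n) :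
    lapM p n a ω (Fin.natAdd n j) (Fin.castAdd a i) = ω (Sum.inr (j, i)) := by
  simp [lapM]

lemma lapM_natAdd_natAdd (j k : Fin a) :
    lapM p n a ω (Fin.natAdd n j) (Fin.natAdd n k) =
      if j = k then -∑ i, ω (Sum.inr (j, i)) else 0 := by
  simp [lapM, Fin.ext_iff]

lemma sum_lapM_castAdd_mul (V : Fin (n + a) → ZMod p) (i : Fin n) :
    ∑ x, lapM p n a ω (Fin.castAdd a i) x * V x =
      ∑ k, (V (Fin.natAdd n k) - V (Fin.castAdd a i)) * ω (Sum.inl (i, k)) := by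
  rw [Fin.sum_univ_add]
  simp_rw [lapM_castAdd_castAdd, lapM_castAdd_natAdd, sub_mul, Finset.sum_sub_distrib,
    ← Finset.mul_sum, ite_mul, zero_mul]
  rw [Finset.sum_ite_eq, if_pos (Finset.mem_univ _)]
  simp_rw [mul_comm (V _)]
  ring

lemma sum_lapM_natAdd_mul (V : Fin (n + a) → ZMod p) (j : Fin a) :
    ∑ x, lapM p n a ω (Fin.natAdd n j) x * V x =
      ∑ i, (V (Fin.castAdd a i) - V (Fin.natAdd n j)) * ω (Sum.inr (j, i)) := by
  rw [Fin.sum_univ_add]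
  simp_rw [lapM_natAdd_castAdd, lapM_natAdd_natAdd, sub_mul, Finset.sum_sub_distrib,
    ← Finset.mul_sum, ite_mul, zero_mul]
  rw [Finset.sum_ite_eq, if_pos (Finset.mem_univ _)]
  simp_rw [mul_comm (V _)]
  ring

end lapM

lemma exists_mulVec_eq_zero_of_rank_ne {K m n : Type*} [Field K] [Fintype m] [Fintype n]
    (A : Matrix m n K) (h : A.rank ≠ Fintype.card n) :
    ∃ v, v ≠ 0 ∧ A.mulVec v = 0 := by
  by_contra! hc
  apply h
  have hinj : Function.Injective A.mulVecLin := by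
    rw [injective_iff_map_eq_zero]
    intro v hv
    by_contra hv0
    exact hc v hv0 hv
  rw [Matrix.rank, LinearMap.finrank_range_of_inj hinj, Module.finrank_fintype_fun_eq_card]

lemma exists_mem_kernelEvent_of_rank_ne (p : ℕ) [Fact p.Prime] {n a b : ℕ} (hnb : n ≤ b)
    (hba : b ≤ n + a) (J : Finset (Fin (n + a))) (ω : LapIdx n a → ZMod p)
    (h : (Matrix.of fun (i : Fin b) (j : J) => firstRows p n a b hba ω i j.val).rank ≠ J.card) :
    ∃ u : Fin n → ZMod p, ∃ w : Fin a → ZMod p,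
      (∀ i ∉ Finset.univ.filter (fun i => Fin.castAdd a i ∈ J), u i = 0) ∧ (u ≠ 0 ∨ w ≠ 0) ∧
        ω ∈ kernelEvent p n a (b - n) u w := by
  obtain ⟨v, hv0, hv⟩ := exists_mulVec_eq_zero_of_rank_ne _ (by rwa [Fintype.card_coe])
  let V : Fin (n + a) → ZMod p := fun x => if hx : x ∈ J then v ⟨x, hx⟩ else 0
  have hrow : ∀ x : Fin (n + a), (x : ℕ) < b → ∑ y, lapM p n a ω x y * V y = 0 := by
    intro x hx
    have h1 := congrFun hv ⟨x, hx⟩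
    rw [Matrix.mulVec, dotProduct, Pi.zero_apply] at h1
    rw [← h1, ← Finset.sum_subset (Finset.subset_univ J), ← Finset.sum_coe_sort]
    · refine Finset.sum_congr rfl fun j _ => ?_
      simp [V, firstRows]
    · intro y _ hy
      simp [V, hy]
  refine ⟨fun i => V (Fin.castAdd a i), fun k => V (Fin.natAdd n k), ?_, ?_, ?_, ?_⟩
  · intro i hi
    have : Fin.castAdd a i ∉ J := by simpa using hi
    simp [V, this]
  · by_contra! hc
    apply hv0
    have hV : ∀ x, V x = 0 := by
      intro x
      induction x using Fin.addCases with
      | left i => exact congrFun hc.1 i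
      | right k => exact congrFun hc.2 k
    ext ⟨x, hx⟩
    simpa [V, hx] using hV x
  · intro i
    rw [← sum_lapM_castAdd_mul p n a ω V]
    exact hrow _ (by simp; omega)
  · intro j hj
    rw [← sum_lapM_natAdd_mul p n a ω V]
    exact hrow _ (by simp; omega)

lemma card_filter_castAdd_mem_add (n a : ℕ) (J : Finset (Fin (n + a)))
    (hJ : ∀ j : Fin (n + a), n ≤ (j : ℕ) → j ∈ J) :
    (Finset.univ.filter fun i : Fin n => Fin.castAdd a i ∈ J).card + a = J.card := by
  have h : J = Finset.univ.filter (· ∈ J) := by simp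
  conv_rhs => rw [h]
  rw [Finset.card_filter, Finset.card_filter, Fin.sum_univ_add]
  congr 1
  rw [Finset.sum_congr rfl (g := fun _ => 1) fun k _ => if_pos (hJ _ (by simp))]
  simp

open Filter Topology in
lemma tendsto_vanishBound (p : ℕ) {l : ℝ} (hl0 : 0 ≤ l) (hl1 : l < 1) :
    Tendsto (vanishBound p l) atTop (𝓝 ((p : ℝ)⁻¹)) := by
  have h := ((((tendsto_pow_atTop_nhds_zero_of_lt_one hl0 hl1).const_mul ((p : ℝ) - 1)).const_add
    1).div_const (p : ℝ))
  have hdef : vanishBound p l = fun s => (1 + (p - 1) * l ^ s) / p := rfl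
  simpa [hdef] using h

open Filter Topology in
lemma exists_exponential_constants (p : ℕ) [Fact p.Prime] {l γ : ℝ} (hl0 : 0 < l) (hl1 : l < 1)
    (hγ : 0 < γ) : ∃ (s : ℕ) (z e η : ℝ), 0 < z ∧ z ≤ 1 ∧ 0 < e ∧ e ≤ 1 / 2 ∧ 0 < η ∧ η < 1 ∧
      (p : ℝ) ^ (2 * e) * vanishBound p l 1 ^ γ ≤ η ∧
      (p : ℝ) ^ (2 * e) * (vanishBound p l 1 * (1 + (p - 1) * z)) ≤ η ∧
      (p : ℝ) ^ (2 * e) * (p * vanishBound p l s *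
        ((1 + (p - 1) * vanishBound p l s) / p) ^ γ) ≤ η := by
  have hp1 : (1 : ℝ) < p := Nat.one_lt_cast.2 (Fact.out : p.Prime).one_lt
  have hp0 : (0 : ℝ) < p := by linarith
  have hpos := vanishBound_pos (p := p) hl0.le
  have h1 : vanishBound p l 1 ^ γ < 1 :=
    Real.rpow_lt_one (hpos 1).le (vanishBound_one_lt_one hl1) hγ
  obtain ⟨s, h3⟩ : ∃ s, p * vanishBound p l s *
      ((1 + (p - 1) * vanishBound p l s) / p) ^ γ < 1 := by
    have ht := tendsto_vanishBound p hl0.le hl1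
    have ht' : Tendsto (fun s => p * vanishBound p l s *
        ((1 + (p - 1) * vanishBound p l s) / p) ^ γ) atTop
        (𝓝 (p * (p : ℝ)⁻¹ * ((1 + (p - 1) * (p : ℝ)⁻¹) / p) ^ γ)) :=
      (ht.const_mul _).mul ((((ht.const_mul _).const_add 1).div_const _).rpow_const
        (Or.inr hγ.le))
    have hlim : p * (p : ℝ)⁻¹ * ((1 + (p - 1) * (p : ℝ)⁻¹) / p) ^ γ < 1 := by
      rw [mul_inv_cancel₀ hp0.ne', one_mul]
      have hinv := inv_pos.2 hp0
      refine Real.rpow_lt_one (div_nonneg ?_ hp0.le) ?_ hγ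
      · nlinarith
      · rw [div_lt_one hp0]
        have : (p : ℝ)⁻¹ < 1 := inv_lt_one_of_one_lt₀ hp1
        nlinarith
    exact (ht'.eventually_lt_const hlim).exists
  obtain ⟨z, h2, hz0, hz1⟩ : ∃ z : ℝ, vanishBound p l 1 * (1 + (p - 1) * z) < 1 ∧ 0 < z ∧
      z ≤ 1 := by
    have ht : Tendsto (fun z : ℝ => vanishBound p l 1 * (1 + (p - 1) * z)) (𝓝[>] 0)
        (𝓝 (vanishBound p l 1 * (1 + (p - 1) * 0))) :=
      (Continuous.tendsto (by fun_prop) 0).mono_left nhdsWithin_le_nhds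
    have hlim : vanishBound p l 1 * (1 + (p - 1) * 0) < 1 := by
      simpa using vanishBound_one_lt_one hl1
    exact ((ht.eventually_lt_const hlim).and (Ioc_mem_nhdsGT one_pos)).exists
  have hD : ∀ c : ℝ, c < 1 → ∀ᶠ e : ℝ in 𝓝[>] 0, (p : ℝ) ^ (2 * e) * c < 1 := by
    intro c hc
    have ht : Tendsto (fun e : ℝ => (p : ℝ) ^ (2 * e) * c) (𝓝[>] 0)
        (𝓝 ((p : ℝ) ^ (2 * (0 : ℝ)) * c)) :=
      (Continuous.tendsto ((Real.continuous_const_rpow hp0.ne').comp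
        (continuous_const.mul continuous_id) |>.mul continuous_const) 0).mono_left
          nhdsWithin_le_nhds
    exact ht.eventually_lt_const (by simpa using hc)
  obtain ⟨e, he1, he2, he3, he0, he4⟩ := ((hD _ h1).and ((hD _ h2).and ((hD _ h3).and
    (Ioc_mem_nhdsGT (show (0 : ℝ) < 1 / 2 by norm_num))))).exists
  refine ⟨s, z, e, max ((p : ℝ) ^ (2 * e) * vanishBound p l 1 ^ γ)
    (max ((p : ℝ) ^ (2 * e) * (vanishBound p l 1 * (1 + (p - 1) * z)))
      ((p : ℝ) ^ (2 * e) * (p * vanishBound p l s *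
        ((1 + (p - 1) * vanishBound p l s) / p) ^ γ))), hz0, hz1, he0, he4, ?_, ?_,
      le_max_left _ _, (le_max_left _ _).trans (le_max_right _ _),
      (le_max_right _ _).trans (le_max_right _ _)⟩
  · exact lt_max_of_lt_left (mul_pos (Real.rpow_pos_of_pos hp0 _)
      (Real.rpow_pos_of_pos (hpos 1) _))
  · exact max_lt he1 (max_lt he2 he3)

lemma firstMoment_le_pow {p : ℕ} [Fact p.Prime] {l γ : ℝ} (hl0 : 0 < l)
    {s : ℕ} {z e η : ℝ} (hz0 : 0 < z)
    (h1 : (p : ℝ) ^ (2 * e) * vanishBound p l 1 ^ γ ≤ η)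
    (h2 : (p : ℝ) ^ (2 * e) * (vanishBound p l 1 * (1 + (p - 1) * z)) ≤ η)
    (h3 : (p : ℝ) ^ (2 * e) * (p * vanishBound p l s *
        ((1 + (p - 1) * vanishBound p l s) / p) ^ γ) ≤ η)
    {n a m t : ℕ} (hma : m ≤ a) (han : a ≤ n) (hm : (m : ℝ) = γ * n) (ht : (t : ℝ) ≤ e * n)
    (htn : t ≤ n) :
    (p : ℝ) ^ t * (vanishBound p l 1 ^ m +
      vanishBound p l 1 ^ (n - t) * (z ^ s)⁻¹ * (1 + (p - 1) * z) ^ a +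
      vanishBound p l s ^ (n - t) *
        ((1 + (p - 1) * vanishBound p l s) ^ m * (p : ℝ) ^ (a - m))) ≤
      (2 + (z ^ s)⁻¹) * η ^ n := by
  have hp1 : (1 : ℝ) < p := Nat.one_lt_cast.2 (Fact.out : p.Prime).one_lt
  have hp0 : (0 : ℝ) < p := by linarith
  have hpos := vanishBound_pos (p := p) hl0.le
  have hinv := inv_le_vanishBound (p := p) hl0.le
  set D := (p : ℝ) ^ (2 * e) with hDdef
  have hD0 : 0 < D := Real.rpow_pos_of_pos hp0 _
  have hzs := inv_pos.2 (pow_pos hz0 s)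
  have hD : (p : ℝ) ^ t * (p : ℝ) ^ t ≤ D ^ n := by
    rw [hDdef, ← Real.rpow_natCast _ n, ← Real.rpow_mul hp0.le, ← pow_add, ← Real.rpow_natCast]
    refine Real.rpow_le_rpow_of_exponent_le hp1.le ?_
    push_cast
    linarith
  have hpt : (p : ℝ) ^ t ≤ D ^ n :=
    (le_mul_of_one_le_left (by positivity) (one_le_pow₀ hp1.le)).trans hD
  have hγpow : ∀ x : ℝ, 0 ≤ x → x ^ m = (x ^ γ) ^ n := by
    intro x hx
    rw [← Real.rpow_natCast (x ^ γ), ← Real.rpow_mul hx, ← hm, Real.rpow_natCast]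
  have hshift : ∀ r, (p : ℝ) ^ t * vanishBound p l r ^ (n - t) ≤
      D ^ n * vanishBound p l r ^ n := by
    intro r
    have h : vanishBound p l r ^ (n - t) ≤ (p : ℝ) ^ t * vanishBound p l r ^ n := by
      calc vanishBound p l r ^ (n - t) =
            (p : ℝ) ^ t * (((p : ℝ)⁻¹) ^ t * vanishBound p l r ^ (n - t)) := by
            rw [← mul_assoc, ← mul_pow, mul_inv_cancel₀ hp0.ne', one_pow, one_mul]
        _ ≤ (p : ℝ) ^ t * (vanishBound p l r ^ t * vanishBound p l r ^ (n - t)) := by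
            have := (hpos r).le
            have := hinv r
            gcongr
        _ = _ := by rw [← pow_add, Nat.add_sub_cancel' htn]
    calc (p : ℝ) ^ t * vanishBound p l r ^ (n - t)
        ≤ (p : ℝ) ^ t * ((p : ℝ) ^ t * vanishBound p l r ^ n) := by gcongr
      _ = ((p : ℝ) ^ t * (p : ℝ) ^ t) * vanishBound p l r ^ n := by ring
      _ ≤ _ := mul_le_mul_of_nonneg_right hD (pow_nonneg (hpos r).le _)
  have t1 : (p : ℝ) ^ t * vanishBound p l 1 ^ m ≤ η ^ n := by
    calc (p : ℝ) ^ t * vanishBound p l 1 ^ m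
        ≤ D ^ n * (vanishBound p l 1 ^ γ) ^ n := by
          rw [hγpow _ (hpos 1).le]
          exact mul_le_mul_of_nonneg_right hpt
            (pow_nonneg (Real.rpow_nonneg (hpos 1).le _) _)
      _ = (D * vanishBound p l 1 ^ γ) ^ n := (mul_pow _ _ _).symm
      _ ≤ η ^ n := pow_le_pow_left₀
          (mul_nonneg hD0.le (Real.rpow_nonneg (hpos 1).le _)) h1 n
  have hz : 1 ≤ 1 + (p - 1) * z := by nlinarith
  have t2 : (p : ℝ) ^ t * (vanishBound p l 1 ^ (n - t) * (z ^ s)⁻¹ * (1 + (p - 1) * z) ^ a) ≤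
      (z ^ s)⁻¹ * η ^ n := by
    have hv := (hpos 1).le
    calc _ = (z ^ s)⁻¹ * (((p : ℝ) ^ t * vanishBound p l 1 ^ (n - t)) *
          (1 + (p - 1) * z) ^ a) := by ring
      _ ≤ (z ^ s)⁻¹ * ((D ^ n * vanishBound p l 1 ^ n) * (1 + (p - 1) * z) ^ n) := by
          refine mul_le_mul_of_nonneg_left (mul_le_mul (hshift 1) (pow_le_pow_right₀ hz han)
            (by positivity) (by positivity)) hzs.le
      _ = (z ^ s)⁻¹ * (D * (vanishBound p l 1 * (1 + (p - 1) * z))) ^ n := by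
          rw [mul_pow, mul_pow]; ring
      _ ≤ _ := by
          refine mul_le_mul_of_nonneg_left (pow_le_pow_left₀ (by positivity) h2 n) hzs.le
  have hx0 : 0 ≤ (1 + (p - 1) * vanishBound p l s) / p := by
    have := mul_nonneg (sub_nonneg.2 hp1.le) (hpos s).le
    positivity
  have t3 : (p : ℝ) ^ t * (vanishBound p l s ^ (n - t) *
        ((1 + (p - 1) * vanishBound p l s) ^ m * (p : ℝ) ^ (a - m))) ≤ η ^ n := by
    have hv := (hpos s).le
    have hprod : (1 + (p - 1) * vanishBound p l s) ^ m * (p : ℝ) ^ (a - m) ≤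
        (p : ℝ) ^ n * (((1 + (p - 1) * vanishBound p l s) / p) ^ γ) ^ n := by
      rw [← hγpow _ hx0]
      calc (1 + (p - 1) * vanishBound p l s) ^ m * (p : ℝ) ^ (a - m)
          = (p : ℝ) ^ a * ((1 + (p - 1) * vanishBound p l s) / p) ^ m := by
            rw [div_pow, ← Nat.sub_add_cancel hma, pow_add, Nat.add_sub_cancel]
            field_simp
        _ ≤ _ := mul_le_mul_of_nonneg_right (pow_le_pow_right₀ hp1.le han) (pow_nonneg hx0 _)
    have hy0 := Real.rpow_nonneg hx0 γ
    calc _ = ((p : ℝ) ^ t * vanishBound p l s ^ (n - t)) *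
          ((1 + (p - 1) * vanishBound p l s) ^ m * (p : ℝ) ^ (a - m)) := by ring
      _ ≤ (D ^ n * vanishBound p l s ^ n) *
          ((p : ℝ) ^ n * (((1 + (p - 1) * vanishBound p l s) / p) ^ γ) ^ n) := by
          have hsub := mul_nonneg (sub_nonneg.2 hp1.le) hv
          exact mul_le_mul (hshift s) hprod (by positivity) (by positivity)
      _ = (D * (p * vanishBound p l s *
          ((1 + (p - 1) * vanishBound p l s) / p) ^ γ)) ^ n := by
          rw [mul_pow, mul_pow, mul_pow]; ring
      _ ≤ _ := pow_le_pow_left₀ (by positivity) h3 n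
  linarith

/-- For `0 < δ < α` and `K = {n+1, …, (1+α)n}` (the last `a = αn` column indices), there
exist `δ' > 0` and `C, c > 0` such that for every set `J` of column indices containing `K`
with `|J| ≤ αn + δ'n`, the column submatrix of `M_{(1+α-δ)n}` on `J` has full column rank
`|J|` with probability at least `1 - C·exp(-cn)`. -/
theorem column_submatrix_full_rank
    (p : ℕ) (hp : p.Prime) (q : ℝ) (hq0 : 0 < q) (hq1 : q < 1)
    (α : ℚ) (hα1 : 1 / (p : ℚ) < α) (hα2 : α ≤ 1)
    (δ : ℚ) (hδ0 : 0 < δ) (hδα : δ < α) :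
    ∃ δ' > (0 : ℝ), ∃ C > (0 : ℝ), ∃ c > (0 : ℝ),
      ∀ n : ℕ, 0 < n → ∀ a : ℕ, (a : ℚ) = α * n →
        ∀ b : ℕ, (b : ℚ) = (1 + α - δ) * n → ∀ hba : b ≤ n + a,
          ∀ J : Finset (Fin (n + a)),
            (∀ j : Fin (n + a), n ≤ (j : ℕ) → j ∈ J) →
            ((J.card : ℝ) ≤ a + δ' * n) →
            1 - C * Real.exp (-c * n) ≤
              ((lapMeasure p n a q)
                {ω | (Matrix.of fun (i : Fin b) (j : J) =>
                    firstRows p n a b hba ω i j.val).rank = J.card}).toReal := by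
  have : Fact p.Prime := ⟨hp⟩
  obtain ⟨l, hl0, hl1, hl⟩ := exists_norm_integral_stdAddChar_le p hq0 hq1
  have hγ : (0 : ℝ) < ((α - δ : ℚ) : ℝ) := by exact_mod_cast sub_pos.2 hδα
  obtain ⟨s, z, e, η, hz0, hz1, he0, he1, hη0, hη1, h1, h2, h3⟩ :=
    exists_exponential_constants p hl0 hl1 hγ
  have hzs := inv_pos.2 (pow_pos hz0 s)
  have hlog : 0 < -Real.log η := neg_pos.2 (Real.log_neg hη0 hη1)
  have hexp : ∀ n : ℕ, Real.exp (-(-Real.log η) * n) = η ^ n := by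
    intro n
    rw [neg_neg, mul_comm, Real.exp_nat_mul, Real.exp_log hη0]
  refine ⟨e, he0, 2 + (z ^ s)⁻¹ + (η ^ (2 * s))⁻¹, by positivity, -Real.log η, hlog, ?_⟩
  intro n hn a ha b hb hba J hJ hcard
  rw [hexp]
  have hηn := pow_pos hη0 n
  rcases lt_or_ge n (2 * s) with hns | hns
  · have hge : 1 ≤ (η ^ (2 * s))⁻¹ * η ^ n := by
      rw [← div_eq_inv_mul, one_le_div (by positivity)]
      exact pow_le_pow_of_le_one hη0.le hη1.le hns.le
    have hpos : 0 ≤ (2 + (z ^ s)⁻¹) * η ^ n := by positivity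
    refine le_trans ?_ ENNReal.toReal_nonneg
    linarith
  have hn0 : (0 : ℚ) < n := Nat.cast_pos.2 hn
  have hnb : n ≤ b := by
    have : (n : ℚ) ≤ b := by rw [hb]; nlinarith
    exact_mod_cast this
  have han : a ≤ n := by
    have : (a : ℚ) ≤ n := by rw [ha]; nlinarith
    exact_mod_cast this
  have hm : ((b - n : ℕ) : ℝ) = ((α - δ : ℚ) : ℝ) * n := by
    have : ((b - n : ℕ) : ℚ) = (α - δ) * n := by
      rw [Nat.cast_sub hnb, hb]
      ring
    exact_mod_cast congrArg (Rat.cast : ℚ → ℝ) this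
  have hT := card_filter_castAdd_mem_add n a J hJ
  set T := Finset.univ.filter fun i : Fin n => Fin.castAdd a i ∈ J with hTdef
  have ht : (T.card : ℝ) ≤ e * n := by
    rw [← hT] at hcard
    push_cast at hcard
    linarith
  have hs : s ≤ n - T.card := by
    have hnR : (0 : ℝ) < n := Nat.cast_pos.2 hn
    have h2t : 2 * T.card ≤ n := by
      have : (2 : ℝ) * T.card ≤ n := by nlinarith
      exact_mod_cast this
    omega
  have hbound := (measureReal_exists_kernelEvent_le p hq0 hq1 hl0 hl1 hl (m := b - n) hz0 hz1
    (by omega : b - n ≤ a) T hs).trans (firstMoment_le_pow hl0 hz0 h1 h2 h3 (by omega) han hm ht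
      ((Finset.card_le_univ T).trans (by simp)))
  have hbern := bern_isProbabilityMeasure p hq0.le hq1.le
  have hprob : IsProbabilityMeasure (lapMeasure p n a q) := by
    rw [lapMeasure]
    infer_instance
  set G : Set (LapIdx n a → ZMod p) := {ω | (Matrix.of fun (i : Fin b) (j : J) =>
    firstRows p n a b hba ω i j.val).rank = J.card} with hG
  have hGc : (lapMeasure p n a q).real Gᶜ ≤ (2 + (z ^ s)⁻¹) * η ^ n :=
    (measureReal_mono (fun ω hω => exists_mem_kernelEvent_of_rank_ne p hnb hba J ω hω)
      (measure_ne_top _ _)).trans hbound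
  rw [probReal_compl_eq_one_sub G.toFinite.measurableSet] at hGc
  have hextra : 0 ≤ (η ^ (2 * s))⁻¹ * η ^ n := by positivity
  have hreal : ((lapMeasure p n a q) G).toReal = (lapMeasure p n a q).real G := rfl
  rw [hreal]
  linarith
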